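/- The algebra E_n(Γ_e) is ℤ-graded: there is a direct sum decomposition E_n(Γ_e) = ⊕_{m ∈ ℤ} E_m into 𝕜-subspaces with E_m · E_{m′} ⊆ E_{m+m′} and 1 ∈ E_0, such that each ē(i,A) lies in E_0, each y_a lies in E_2, and ψ_a ē(i,A) lies in E_m where m = 0 if i_a ⌿ i_{a+1} or a ≁_A (a+1), m = 1 if (i_a → i_{a+1} or i_a ← i_{a+1}) and a ∼_A (a+1), and m = −2 if i_a = i_{a+1} and a ∼_A (a+1). -/

import Mathlib

open scoped Classical

noncomputable section

namespace EG

instance (n : ℕ) : Finite (Setoid (Fin n)) :=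
  Finite.of_injective (fun A : Setoid (Fin n) => A.r)
    (fun A B h => by cases A; cases B; simp only at h; subst h; rfl)

noncomputable instance (n : ℕ) : Fintype (Setoid (Fin n)) := Fintype.ofFinite _

/-- Generators of the algebra `E_n(Γ_e)` (0-based indexing for `ψ`). -/
inductive Gen (e n : ℕ) : Type
  | eb : (Fin n → ZMod e) → Setoid (Fin n) → Gen e n
  | y : Fin n → Gen e n
  | psi : (a : ℕ) → a + 1 < n → Gen e n

variable (𝕜 : Type) [Field 𝕜] (e n : ℕ)

abbrev F : Type := FreeAlgebra 𝕜 (Gen e n)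

def Eb (i : Fin n → ZMod e) (A : Setoid (Fin n)) : F 𝕜 e n :=
  FreeAlgebra.ι 𝕜 (Gen.eb i A)

def Yy (a : Fin n) : F 𝕜 e n := FreeAlgebra.ι 𝕜 (Gen.y a)

def Ps (a : ℕ) (h : a + 1 < n) : F 𝕜 e n := FreeAlgebra.ι 𝕜 (Gen.psi a h)

/-- The simple transposition `σ_a = (a, a+1)` (0-based). -/
def sw (a : ℕ) (h : a + 1 < n) : Equiv.Perm (Fin n) :=
  Equiv.swap ⟨a, by omega⟩ ⟨a + 1, h⟩

/-- The action of a permutation on set partitions. -/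
def permSetoid {n : ℕ} (σ : Equiv.Perm (Fin n)) (A : Setoid (Fin n)) : Setoid (Fin n) where
  r x y := A.r (σ.symm x) (σ.symm y)
  iseqv := ⟨fun _ => A.iseqv.refl _, fun h => A.iseqv.symm h, fun h h' => A.iseqv.trans h h'⟩

/-- The defining relations of `E_n(Γ_e)`. -/
inductive Rel : F 𝕜 e n → F 𝕜 e n → Prop
  | cyclo1 (h0 : 0 < n) (i : Fin n → ZMod e) (A : Setoid (Fin n)) (hi : i ⟨0, h0⟩ = 0) :
      Rel (Yy 𝕜 e n ⟨0, h0⟩ * Eb 𝕜 e n i A) 0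
  | cyclo2 (h0 : 0 < n) (i : Fin n → ZMod e) (A : Setoid (Fin n)) (hi : i ⟨0, h0⟩ ≠ 0) :
      Rel (Eb 𝕜 e n i A) 0
  | unit [Fintype (ZMod e)] :
      Rel (∑ i : Fin n → ZMod e, ∑ A : Setoid (Fin n), Eb 𝕜 e n i A) 1
  | orth (i i' : Fin n → ZMod e) (A A' : Setoid (Fin n)) :
      Rel (Eb 𝕜 e n i A * Eb 𝕜 e n i' A')
        (if i = i' ∧ A = A' then Eb 𝕜 e n i A else 0)
  | ye (a : Fin n) (i : Fin n → ZMod e) (A : Setoid (Fin n)) :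
      Rel (Yy 𝕜 e n a * Eb 𝕜 e n i A) (Eb 𝕜 e n i A * Yy 𝕜 e n a)
  | pe (a : ℕ) (h : a + 1 < n) (i : Fin n → ZMod e) (A : Setoid (Fin n)) :
      Rel (Ps 𝕜 e n a h * Eb 𝕜 e n i A)
        (Eb 𝕜 e n (i ∘ (sw n a h)) (permSetoid (sw n a h) A) * Ps 𝕜 e n a h)
  | yy (a b : Fin n) :
      Rel (Yy 𝕜 e n a * Yy 𝕜 e n b) (Yy 𝕜 e n b * Yy 𝕜 e n a)
  | pp (a b : ℕ) (ha : a + 1 < n) (hb : b + 1 < n) (hab : a + 1 < b) :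
      Rel (Ps 𝕜 e n a ha * Ps 𝕜 e n b hb) (Ps 𝕜 e n b hb * Ps 𝕜 e n a ha)
  | py_eq (a : ℕ) (h : a + 1 < n) (i : Fin n → ZMod e) (A : Setoid (Fin n))
      (hc : i ⟨a, by omega⟩ = i ⟨a + 1, h⟩ ∧ A.r ⟨a, by omega⟩ ⟨a + 1, h⟩) :
      Rel (Ps 𝕜 e n a h * Yy 𝕜 e n ⟨a + 1, h⟩ * Eb 𝕜 e n i A)
        ((Yy 𝕜 e n ⟨a, by omega⟩ * Ps 𝕜 e n a h + 1) * Eb 𝕜 e n i A)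
  | py_ne (a : ℕ) (h : a + 1 < n) (i : Fin n → ZMod e) (A : Setoid (Fin n))
      (hc : ¬(i ⟨a, by omega⟩ = i ⟨a + 1, h⟩ ∧ A.r ⟨a, by omega⟩ ⟨a + 1, h⟩)) :
      Rel (Ps 𝕜 e n a h * Yy 𝕜 e n ⟨a + 1, h⟩ * Eb 𝕜 e n i A)
        (Yy 𝕜 e n ⟨a, by omega⟩ * Ps 𝕜 e n a h * Eb 𝕜 e n i A)
  | yp_eq (a : ℕ) (h : a + 1 < n) (i : Fin n → ZMod e) (A : Setoid (Fin n))
      (hc : i ⟨a, by omega⟩ = i ⟨a + 1, h⟩ ∧ A.r ⟨a, by omega⟩ ⟨a + 1, h⟩) :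
      Rel (Yy 𝕜 e n ⟨a + 1, h⟩ * Ps 𝕜 e n a h * Eb 𝕜 e n i A)
        ((Ps 𝕜 e n a h * Yy 𝕜 e n ⟨a, by omega⟩ + 1) * Eb 𝕜 e n i A)
  | yp_ne (a : ℕ) (h : a + 1 < n) (i : Fin n → ZMod e) (A : Setoid (Fin n))
      (hc : ¬(i ⟨a, by omega⟩ = i ⟨a + 1, h⟩ ∧ A.r ⟨a, by omega⟩ ⟨a + 1, h⟩)) :
      Rel (Yy 𝕜 e n ⟨a + 1, h⟩ * Ps 𝕜 e n a h * Eb 𝕜 e n i A)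
        (Ps 𝕜 e n a h * Yy 𝕜 e n ⟨a, by omega⟩ * Eb 𝕜 e n i A)
  | sq_eq (a : ℕ) (h : a + 1 < n) (i : Fin n → ZMod e) (A : Setoid (Fin n))
      (hc : i ⟨a, by omega⟩ = i ⟨a + 1, h⟩ ∧ A.r ⟨a, by omega⟩ ⟨a + 1, h⟩) :
      Rel (Ps 𝕜 e n a h ^ 2 * Eb 𝕜 e n i A) 0
  | sq_far (a : ℕ) (h : a + 1 < n) (i : Fin n → ZMod e) (A : Setoid (Fin n))
      (hc : (i ⟨a + 1, h⟩ ≠ i ⟨a, by omega⟩ - 1 ∧ i ⟨a + 1, h⟩ ≠ i ⟨a, by omega⟩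
              ∧ i ⟨a + 1, h⟩ ≠ i ⟨a, by omega⟩ + 1)
            ∨ ¬ A.r ⟨a, by omega⟩ ⟨a + 1, h⟩) :
      Rel (Ps 𝕜 e n a h ^ 2 * Eb 𝕜 e n i A) (Eb 𝕜 e n i A)
  | sq_r (a : ℕ) (h : a + 1 < n) (i : Fin n → ZMod e) (A : Setoid (Fin n))
      (hc : i ⟨a + 1, h⟩ = i ⟨a, by omega⟩ + 1 ∧ A.r ⟨a, by omega⟩ ⟨a + 1, h⟩) :
      Rel (Ps 𝕜 e n a h ^ 2 * Eb 𝕜 e n i A)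
        ((Yy 𝕜 e n ⟨a + 1, h⟩ - Yy 𝕜 e n ⟨a, by omega⟩) * Eb 𝕜 e n i A)
  | sq_l (a : ℕ) (h : a + 1 < n) (i : Fin n → ZMod e) (A : Setoid (Fin n))
      (hc : i ⟨a + 1, h⟩ = i ⟨a, by omega⟩ - 1 ∧ A.r ⟨a, by omega⟩ ⟨a + 1, h⟩) :
      Rel (Ps 𝕜 e n a h ^ 2 * Eb 𝕜 e n i A)
        ((Yy 𝕜 e n ⟨a, by omega⟩ - Yy 𝕜 e n ⟨a + 1, h⟩) * Eb 𝕜 e n i A)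
  | br_r (a : ℕ) (h : a + 2 < n) (i : Fin n → ZMod e) (A : Setoid (Fin n))
      (hc : i ⟨a + 2, h⟩ = i ⟨a, by omega⟩ ∧ i ⟨a + 1, by omega⟩ = i ⟨a, by omega⟩ + 1
        ∧ A.r ⟨a, by omega⟩ ⟨a + 1, by omega⟩ ∧ A.r ⟨a + 1, by omega⟩ ⟨a + 2, h⟩) :
      Rel (Ps 𝕜 e n (a + 1) h * Ps 𝕜 e n a (by omega) * Ps 𝕜 e n (a + 1) h
            * Eb 𝕜 e n i A)
        ((Ps 𝕜 e n a (by omega) * Ps 𝕜 e n (a + 1) h * Ps 𝕜 e n a (by omega) - 1)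
            * Eb 𝕜 e n i A)
  | br_l (a : ℕ) (h : a + 2 < n) (i : Fin n → ZMod e) (A : Setoid (Fin n))
      (hc : i ⟨a + 2, h⟩ = i ⟨a, by omega⟩ ∧ i ⟨a + 1, by omega⟩ = i ⟨a, by omega⟩ - 1
        ∧ A.r ⟨a, by omega⟩ ⟨a + 1, by omega⟩ ∧ A.r ⟨a + 1, by omega⟩ ⟨a + 2, h⟩) :
      Rel (Ps 𝕜 e n (a + 1) h * Ps 𝕜 e n a (by omega) * Ps 𝕜 e n (a + 1) h
            * Eb 𝕜 e n i A)
        ((Ps 𝕜 e n a (by omega) * Ps 𝕜 e n (a + 1) h * Ps 𝕜 e n a (by omega) + 1)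
            * Eb 𝕜 e n i A)
  | br_o (a : ℕ) (h : a + 2 < n) (i : Fin n → ZMod e) (A : Setoid (Fin n))
      (hc : ¬(i ⟨a + 2, h⟩ = i ⟨a, by omega⟩ ∧ i ⟨a + 1, by omega⟩ = i ⟨a, by omega⟩ + 1
              ∧ A.r ⟨a, by omega⟩ ⟨a + 1, by omega⟩ ∧ A.r ⟨a + 1, by omega⟩ ⟨a + 2, h⟩)
          ∧ ¬(i ⟨a + 2, h⟩ = i ⟨a, by omega⟩ ∧ i ⟨a + 1, by omega⟩ = i ⟨a, by omega⟩ - 1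
              ∧ A.r ⟨a, by omega⟩ ⟨a + 1, by omega⟩ ∧ A.r ⟨a + 1, by omega⟩ ⟨a + 2, h⟩)) :
      Rel (Ps 𝕜 e n (a + 1) h * Ps 𝕜 e n a (by omega) * Ps 𝕜 e n (a + 1) h
            * Eb 𝕜 e n i A)
        (Ps 𝕜 e n a (by omega) * Ps 𝕜 e n (a + 1) h * Ps 𝕜 e n a (by omega)
            * Eb 𝕜 e n i A)

/-- The algebra `E_n(Γ_e)`. -/
abbrev E : Type := RingQuot (Rel 𝕜 e n)

def π : F 𝕜 e n →ₐ[𝕜] E 𝕜 e n := RingQuot.mkAlgHom 𝕜 (Rel 𝕜 e n)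

def ebar (i : Fin n → ZMod e) (A : Setoid (Fin n)) : E 𝕜 e n := π 𝕜 e n (Eb 𝕜 e n i A)

def y (a : Fin n) : E 𝕜 e n := π 𝕜 e n (Yy 𝕜 e n a)

def psi (a : ℕ) (h : a + 1 < n) : E 𝕜 e n := π 𝕜 e n (Ps 𝕜 e n a h)

end EG

namespace EG

variable {𝕜 : Type} [Field 𝕜] {e n : ℕ}

theorem π_eq_of_rel {x x' : F 𝕜 e n} (h : Rel 𝕜 e n x x') : π 𝕜 e n x = π 𝕜 e n x' :=
  RingQuot.mkAlgHom_rel 𝕜 h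

theorem π_Eb (i : Fin n → ZMod e) (A : Setoid (Fin n)) :
    π 𝕜 e n (Eb 𝕜 e n i A) = ebar 𝕜 e n i A := rfl

theorem π_Yy (a : Fin n) : π 𝕜 e n (Yy 𝕜 e n a) = y 𝕜 e n a := rfl

theorem π_Ps (a : ℕ) (h : a + 1 < n) : π 𝕜 e n (Ps 𝕜 e n a h) = psi 𝕜 e n a h := rfl

theorem ebar_mul_ebar (i i' : Fin n → ZMod e) (A A' : Setoid (Fin n)) :
    ebar 𝕜 e n i A * ebar 𝕜 e n i' A' = if i = i' ∧ A = A' then ebar 𝕜 e n i A else 0 := by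
  have h := π_eq_of_rel (Rel.orth (𝕜 := 𝕜) i i' A A')
  rw [map_mul] at h
  split_ifs with hc
  · rwa [if_pos hc] at h
  · rwa [if_neg hc, map_zero] at h

theorem ebar_mul_self (i : Fin n → ZMod e) (A : Setoid (Fin n)) :
    ebar 𝕜 e n i A * ebar 𝕜 e n i A = ebar 𝕜 e n i A := by
  simp [ebar_mul_ebar]

theorem y_mul_ebar (a : Fin n) (i : Fin n → ZMod e) (A : Setoid (Fin n)) :
    y 𝕜 e n a * ebar 𝕜 e n i A = ebar 𝕜 e n i A * y 𝕜 e n a := by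
  simpa only [map_mul, π_Yy, π_Eb] using π_eq_of_rel (Rel.ye (𝕜 := 𝕜) a i A)

theorem psi_mul_ebar (a : ℕ) (h : a + 1 < n) (i : Fin n → ZMod e) (A : Setoid (Fin n)) :
    psi 𝕜 e n a h * ebar 𝕜 e n i A =
      ebar 𝕜 e n (i ∘ sw n a h) (permSetoid (sw n a h) A) * psi 𝕜 e n a h := by
  simpa only [map_mul, π_Ps, π_Eb] using π_eq_of_rel (Rel.pe (𝕜 := 𝕜) a h i A)

theorem ebar_mul_y_mul {i : Fin n → ZMod e} {A : Setoid (Fin n)} {x : E 𝕜 e n}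
    (hx : ebar 𝕜 e n i A * x = x) (a : Fin n) :
    ebar 𝕜 e n i A * (y 𝕜 e n a * x) = y 𝕜 e n a * x := by
  rw [← mul_assoc, ← y_mul_ebar, mul_assoc, hx]

theorem ebar_mul_psi_mul {i : Fin n → ZMod e} {A : Setoid (Fin n)} {x : E 𝕜 e n}
    (hx : ebar 𝕜 e n i A * x = x) (a : ℕ) (h : a + 1 < n) :
    ebar 𝕜 e n (i ∘ sw n a h) (permSetoid (sw n a h) A) * (psi 𝕜 e n a h * x) =
      psi 𝕜 e n a h * x := by
  rw [← mul_assoc, ← psi_mul_ebar, mul_assoc, hx]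

/-! ### Simple transpositions -/

theorem sw_left (a : ℕ) (h : a + 1 < n) (h' : a < n) : sw n a h ⟨a, h'⟩ = ⟨a + 1, h⟩ :=
  Equiv.swap_apply_left _ _

theorem sw_right (a : ℕ) (h h' : a + 1 < n) : sw n a h ⟨a + 1, h'⟩ = ⟨a, by omega⟩ :=
  Equiv.swap_apply_right _ _

theorem sw_of_ne (a : ℕ) (h : a + 1 < n) (b : ℕ) (hb : b < n) (h1 : b ≠ a) (h2 : b ≠ a + 1) :
    sw n a h ⟨b, hb⟩ = ⟨b, hb⟩ :=
  Equiv.swap_apply_of_ne_of_ne (by simpa using h1) (by simpa using h2)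

theorem sw_symm (a : ℕ) (h : a + 1 < n) : (sw n a h).symm = sw n a h :=
  Equiv.symm_swap _ _

theorem permSetoid_sw_r (a : ℕ) (h : a + 1 < n) (A : Setoid (Fin n)) (p q : Fin n) :
    (permSetoid (sw n a h) A).r p q ↔ A.r (sw n a h p) (sw n a h q) := by
  change A.r _ _ ↔ _
  rw [sw_symm]

theorem permSetoid_sw_self (a : ℕ) (h : a + 1 < n) (A : Setoid (Fin n)) :
    permSetoid (sw n a h) (permSetoid (sw n a h) A) = A := by
  ext p q
  change A.r ((sw n a h).symm ((sw n a h).symm p)) ((sw n a h).symm ((sw n a h).symm q)) ↔ A.r p q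
  simp [sw]

/-! ### Vanishing of all but finitely many idempotents -/

theorem psi_psi_ebar_of_far (a : ℕ) (h : a + 1 < n) (i : Fin n → ZMod e) (A : Setoid (Fin n))
    (hc : (i ⟨a + 1, h⟩ ≠ i ⟨a, by omega⟩ - 1 ∧ i ⟨a + 1, h⟩ ≠ i ⟨a, by omega⟩
              ∧ i ⟨a + 1, h⟩ ≠ i ⟨a, by omega⟩ + 1)
            ∨ ¬ A.r ⟨a, by omega⟩ ⟨a + 1, h⟩) :
    psi 𝕜 e n a h * (psi 𝕜 e n a h * ebar 𝕜 e n i A) = ebar 𝕜 e n i A := by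
  simpa only [map_mul, pow_two, mul_assoc, π_Ps, π_Eb] using
    π_eq_of_rel (Rel.sq_far (𝕜 := 𝕜) a h i A hc)

/-- An idempotent vanishes if some nonzero residue can be moved to the front. -/
theorem ebar_eq_zero_of_far (k : ℕ) : ∀ (hk : k < n) (i : Fin n → ZMod e) (A : Setoid (Fin n)),
    i ⟨k, hk⟩ ≠ 0 →
    (∀ (j : ℕ) (hj : j < k), (i ⟨k, hk⟩ ≠ i ⟨j, by omega⟩ - 1 ∧ i ⟨k, hk⟩ ≠ i ⟨j, by omega⟩
        ∧ i ⟨k, hk⟩ ≠ i ⟨j, by omega⟩ + 1) ∨ ¬ A.r ⟨j, by omega⟩ ⟨k, hk⟩) →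
    ebar 𝕜 e n i A = 0 := by
  induction k with
  | zero =>
    intro hk i A hi _
    simpa only [map_zero, π_Eb] using π_eq_of_rel (Rel.cyclo2 (𝕜 := 𝕜) hk i A hi)
  | succ k ih =>
    intro hk i A hi hfar
    rw [← psi_psi_ebar_of_far k hk i A (hfar k (by omega)), psi_mul_ebar,
      ih (by omega) (i ∘ sw n k hk) (permSetoid (sw n k hk) A), zero_mul, mul_zero]
    · simpa [sw_left] using hi
    · intro j hj
      simpa only [Function.comp_apply, permSetoid_sw_r, sw_left,
        sw_of_ne k hk j (by omega) (by omega) (by omega)] using hfar j (by omega)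

theorem natAbs_le_of_ebar_ne_zero (i : Fin n → ZMod 0) (A : Setoid (Fin n))
    (h : ebar 𝕜 0 n i A ≠ 0) (k : ℕ) (hk : k < n) : Int.natAbs (i ⟨k, hk⟩) ≤ k := by
  induction k using Nat.strong_induction_on with
  | _ k ih =>
    by_contra hlt
    refine h (ebar_eq_zero_of_far k hk i A ?_ fun j hj => Or.inl ?_)
    · intro h0
      apply hlt
      rw [h0]
      exact Nat.zero_le k
    · have hj' := ih j hj (by omega)
      generalize i ⟨k, hk⟩ = u at *
      generalize i ⟨j, _⟩ = v at *
      change ℤ at u v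
      refine ⟨fun (hu : u = v - (1 : ℤ)) => ?_, fun (hu : u = v) => ?_,
        fun (hu : u = v + (1 : ℤ)) => ?_⟩ <;> omega

theorem exists_finset_ebar_eq_zero (𝕜 : Type) [Field 𝕜] (e n : ℕ) :
    ∃ S : Finset ((Fin n → ZMod e) × Setoid (Fin n)),
      ∀ i A, (i, A) ∉ S → ebar 𝕜 e n i A = 0 := by
  rcases Nat.eq_zero_or_pos e with rfl | he
  · have hT : {i : Fin n → ZMod 0 | ∀ k : Fin n, i k ∈ Set.Icc (α := ℤ) (-n) n}.Finite :=
      Set.Finite.pi' fun _ => Set.finite_Icc (-n : ℤ) n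
    refine ⟨hT.toFinset ×ˢ Finset.univ, fun i A hiA => ?_⟩
    by_contra hne
    apply hiA
    simp only [Finset.mem_product, Set.Finite.mem_toFinset, Finset.mem_univ, and_true]
    intro k
    have hk := natAbs_le_of_ebar_ne_zero i A hne k.1 k.2
    have hkn := k.2
    generalize i k = u at *
    change ℤ at u
    change -(n : ℤ) ≤ u ∧ u ≤ n
    omega
  · have : NeZero e := ⟨he.ne'⟩
    exact ⟨Finset.univ, fun i A hiA => absurd (Finset.mem_univ _) hiA⟩

/-! ### Degrees -/

/-- The degree of a crossing of the strands in positions `p` and `q`. -/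
def crossDeg (i : Fin n → ZMod e) (A : Setoid (Fin n)) (p q : Fin n) : ℤ :=
  if A.r p q then if i q = i p then -2 else if i q = i p + 1 ∨ i q = i p - 1 then 1 else 0 else 0

theorem crossDeg_comm (i : Fin n → ZMod e) (A : Setoid (Fin n)) (p q : Fin n) :
    crossDeg i A p q = crossDeg i A q p := by
  have h1 : A.r p q ↔ A.r q p := ⟨A.symm, A.symm⟩
  have h2 : (i q = i p + 1 ∨ i q = i p - 1) ↔ (i p = i q + 1 ∨ i p = i q - 1) := by grind
  simp only [crossDeg, h1, h2, eq_comm (a := i q) (b := i p)]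

theorem crossDeg_sw (a : ℕ) (h : a + 1 < n) (i : Fin n → ZMod e) (A : Setoid (Fin n))
    (p q : Fin n) :
    crossDeg (i ∘ sw n a h) (permSetoid (sw n a h) A) p q =
      crossDeg i A (sw n a h p) (sw n a h q) := by
  simp only [crossDeg, permSetoid_sw_r, Function.comp_apply]

theorem crossDeg_of_eq {i : Fin n → ZMod e} {A : Setoid (Fin n)} {p q : Fin n}
    (h : i p = i q) (hA : A.r p q) : crossDeg i A p q = -2 := by
  simp [crossDeg, h, hA]

theorem crossDeg_of_far {i : Fin n → ZMod e} {A : Setoid (Fin n)} {p q : Fin n}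
    (h : (i q ≠ i p - 1 ∧ i q ≠ i p ∧ i q ≠ i p + 1) ∨ ¬ A.r p q) : crossDeg i A p q = 0 := by
  rcases h with ⟨h1, h2, h3⟩ | h
  · simp [crossDeg, h1, h2, h3]
  · simp [crossDeg, h]

theorem crossDeg_of_adj (he : e = 0 ∨ 3 ≤ e) {i : Fin n → ZMod e} {A : Setoid (Fin n)}
    {p q : Fin n} (h : i q = i p + 1 ∨ i q = i p - 1) (hA : A.r p q) : crossDeg i A p q = 1 := by
  have h1 : (1 : ZMod e) ≠ 0 := by
    have : Nontrivial (ZMod e) := ZMod.nontrivial_iff.2 (by omega)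
    exact one_ne_zero
  have hne : i q ≠ i p := by
    rcases h with h | h <;> simp [h, h1]
  simp [crossDeg, hne, h, hA]

/-! ### The coaction -/

open AddMonoidAlgebra in
/-- The image of `ψ_a` under the coaction, where `S` indexes the nonzero idempotents. -/
def coPsi (S : Finset ((Fin n → ZMod e) × Setoid (Fin n))) (a : ℕ) (h : a + 1 < n) :
    AddMonoidAlgebra (E 𝕜 e n) ℤ :=
  (∑ s ∈ S, single (crossDeg s.1 s.2 ⟨a, by omega⟩ ⟨a + 1, h⟩)
      (psi 𝕜 e n a h * ebar 𝕜 e n s.1 s.2)) +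
    single 0 (psi 𝕜 e n a h * (1 - ∑ s ∈ S, ebar 𝕜 e n s.1 s.2))

section Coaction

open AddMonoidAlgebra

variable {S : Finset ((Fin n → ZMod e) × Setoid (Fin n))}

theorem sum_ebar_mul (hS : ∀ i A, (i, A) ∉ S → ebar 𝕜 e n i A = 0) {i : Fin n → ZMod e}
    {A : Setoid (Fin n)} {x : E 𝕜 e n} (hx : ebar 𝕜 e n i A * x = x) :
    (∑ s ∈ S, ebar 𝕜 e n s.1 s.2) * x = x := by
  by_cases hiA : (i, A) ∈ S
  · rw [Finset.sum_mul, Finset.sum_eq_single_of_mem _ hiA, hx]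
    rintro ⟨j, B⟩ _ hne
    rw [← hx, ← mul_assoc, ebar_mul_ebar, if_neg, zero_mul]
    rintro ⟨rfl, rfl⟩
    exact hne rfl
  · rw [← hx, hS i A hiA, zero_mul, mul_zero]

theorem coPsi_mul_single (hS : ∀ i A, (i, A) ∉ S → ebar 𝕜 e n i A = 0) {i : Fin n → ZMod e}
    {A : Setoid (Fin n)} {x : E 𝕜 e n} (hx : ebar 𝕜 e n i A * x = x) (a : ℕ) (h : a + 1 < n)
    (m : ℤ) :
    coPsi S a h * single m x =
      single (crossDeg i A ⟨a, by omega⟩ ⟨a + 1, h⟩ + m) (psi 𝕜 e n a h * x) := by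
  by_cases hiA : (i, A) ∈ S
  · rw [coPsi, add_mul, single_mul_single, mul_assoc, sub_mul, sum_ebar_mul hS hx, one_mul,
      sub_self, mul_zero, single_zero, add_zero, Finset.sum_mul,
      Finset.sum_eq_single_of_mem _ hiA, single_mul_single, mul_assoc, hx]
    rintro ⟨j, B⟩ _ hne
    rw [single_mul_single, mul_assoc, ← hx, ← mul_assoc (ebar _ _ _ _ _), ebar_mul_ebar, if_neg,
      zero_mul, mul_zero, single_zero]
    rintro ⟨rfl, rfl⟩
    exact hne rfl
  · rw [← hx, hS i A hiA, zero_mul]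
    simp

/-- Elements annihilated by all idempotents are multiplied by `ψ_a` in degree zero. -/
theorem coPsi_mul_single_of_ebar_mul_eq_zero {x : E 𝕜 e n}
    (hx : ∀ i A, ebar 𝕜 e n i A * x = 0) (a : ℕ) (h : a + 1 < n) (m : ℤ) :
    coPsi S a h * single m x = single m (psi 𝕜 e n a h * x) := by
  rw [coPsi, add_mul, Finset.sum_mul, Finset.sum_eq_zero, zero_add, single_mul_single, mul_assoc,
    sub_mul, Finset.sum_mul, Finset.sum_eq_zero, sub_zero, one_mul, zero_add]
  · exact fun s _ => hx _ _
  · intro s _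
    rw [single_mul_single, mul_assoc, hx, mul_zero, single_zero]

theorem ebar_mul_psi_mul_eq_zero {x : E 𝕜 e n} (hx : ∀ i A, ebar 𝕜 e n i A * x = 0)
    (a : ℕ) (h : a + 1 < n) (i : Fin n → ZMod e) (A : Setoid (Fin n)) :
    ebar 𝕜 e n i A * (psi 𝕜 e n a h * x) = 0 := by
  have h1 := psi_mul_ebar (𝕜 := 𝕜) a h (i ∘ sw n a h) (permSetoid (sw n a h) A)
  have h2 : (i ∘ sw n a h) ∘ sw n a h = i := by
    ext p
    simp [sw]
  rw [permSetoid_sw_self, h2] at h1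
  rw [← mul_assoc, ← h1, mul_assoc, hx, mul_zero]

theorem ebar_mul_one_sub_sum (hS : ∀ i A, (i, A) ∉ S → ebar 𝕜 e n i A = 0) (i : Fin n → ZMod e)
    (A : Setoid (Fin n)) : ebar 𝕜 e n i A * (1 - ∑ s ∈ S, ebar 𝕜 e n s.1 s.2) = 0 := by
  rw [mul_sub, mul_one, sub_eq_zero]
  by_cases hiA : (i, A) ∈ S
  · rw [Finset.mul_sum, Finset.sum_eq_single_of_mem _ hiA, ebar_mul_self]
    rintro ⟨j, B⟩ _ hne
    rw [ebar_mul_ebar, if_neg]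
    rintro ⟨rfl, rfl⟩
    exact hne rfl
  · rw [hS i A hiA, zero_mul]

theorem eq_of_mul_single_eq (hS : ∀ i A, (i, A) ∉ S → ebar 𝕜 e n i A = 0)
    {u v : AddMonoidAlgebra (E 𝕜 e n) ℤ}
    (h1 : ∀ i A, u * single 0 (ebar 𝕜 e n i A) = v * single 0 (ebar 𝕜 e n i A))
    (h2 : ∀ x : E 𝕜 e n, (∀ i A, ebar 𝕜 e n i A * x = 0) → u * single 0 x = v * single 0 x) :
    u = v := by
  have hone : (1 : AddMonoidAlgebra (E 𝕜 e n) ℤ) =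
      single 0 (1 - ∑ s ∈ S, ebar 𝕜 e n s.1 s.2) + ∑ s ∈ S, single 0 (ebar 𝕜 e n s.1 s.2) := by
    have : ∑ s ∈ S, single (0 : ℤ) (ebar 𝕜 e n s.1 s.2) =
        single (0 : ℤ) (∑ s ∈ S, ebar 𝕜 e n s.1 s.2) :=
      (map_sum (singleAddHom (0 : ℤ)) _ _).symm
    rw [this, ← single_add, sub_add_cancel, one_def]
  rw [← mul_one u, ← mul_one v, hone, mul_add, mul_add, Finset.mul_sum, Finset.mul_sum,
    h2 _ (ebar_mul_one_sub_sum hS)]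
  simp only [h1]

/-- The coaction on the free algebra. -/
def coF (S : Finset ((Fin n → ZMod e) × Setoid (Fin n))) :
    F 𝕜 e n →ₐ[𝕜] AddMonoidAlgebra (E 𝕜 e n) ℤ :=
  FreeAlgebra.lift 𝕜 fun g => match g with
    | Gen.eb i A => single 0 (ebar 𝕜 e n i A)
    | Gen.y a => single 2 (y 𝕜 e n a)
    | Gen.psi a h => coPsi S a h

theorem coF_Eb (i : Fin n → ZMod e) (A : Setoid (Fin n)) :
    coF S (Eb 𝕜 e n i A) = single 0 (ebar 𝕜 e n i A) := by
  simp [coF, Eb]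

theorem coF_Yy (a : Fin n) : coF S (Yy 𝕜 e n a) = single 2 (y 𝕜 e n a) := by
  simp [coF, Yy]

theorem coF_Ps (a : ℕ) (h : a + 1 < n) : coF S (Ps 𝕜 e n a h) = coPsi S a h := by
  simp [coF, Ps]

theorem coF_eq_of_rel (he : e = 0 ∨ 3 ≤ e) (hS : ∀ i A, (i, A) ∉ S → ebar 𝕜 e n i A = 0)
    {x x' : F 𝕜 e n} (hr : Rel 𝕜 e n x x') : coF S x = coF S x' := by
  have psi1 (i A a) (h : a + 1 < n) (m : ℤ) := coPsi_mul_single hS (ebar_mul_self i A) a h m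
  have psiy (i A b a) (h : a + 1 < n) (m : ℤ) :=
    coPsi_mul_single hS (ebar_mul_y_mul (ebar_mul_self i A) b) a h m
  have psi2 (i A b) (hb : b + 1 < n) (a) (h : a + 1 < n) (m : ℤ) :=
    coPsi_mul_single hS (ebar_mul_psi_mul (ebar_mul_self i A) b hb) a h m
  have psi3 (i A c) (hc : c + 1 < n) (b) (hb : b + 1 < n) (a) (h : a + 1 < n) (m : ℤ) :=
    coPsi_mul_single hS (ebar_mul_psi_mul (ebar_mul_psi_mul (ebar_mul_self i A) c hc) b hb) a h m
  have hπ := π_eq_of_rel hr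
  cases hr with
  | cyclo1 h0 i A hi =>
    simp only [map_mul, map_zero, π_Yy, π_Eb] at hπ
    simp only [map_mul, map_zero, coF_Yy, coF_Eb, single_mul_single, hπ, single_zero]
  | cyclo2 h0 i A hi =>
    simp only [map_zero, π_Eb] at hπ
    simp only [map_zero, coF_Eb, hπ, single_zero]
  | unit =>
    simp only [map_sum, map_one, π_Eb] at hπ
    have hs (x : E 𝕜 e n) : single (0 : ℤ) x = singleAddHom (0 : ℤ) x := rfl
    simp only [map_sum, map_one, coF_Eb, one_def, ← hπ, hs]
  | orth i i' A A' =>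
    rw [map_mul, coF_Eb, coF_Eb, single_mul_single, ebar_mul_ebar]
    split_ifs <;> simp [coF_Eb]
  | ye a i A =>
    simp only [map_mul, coF_Yy, coF_Eb, single_mul_single, y_mul_ebar, add_comm]
  | pe a h i A =>
    rw [map_mul, map_mul, coF_Eb, coF_Eb, coF_Ps]
    refine eq_of_mul_single_eq hS (fun j B => ?_) (fun x hx => ?_)
    · rw [mul_assoc, mul_assoc, psi1, single_mul_single, single_mul_single, psi_mul_ebar a h j B,
        ← mul_assoc, ebar_mul_ebar, ebar_mul_ebar]
      by_cases hij : i = j ∧ A = B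
      · obtain ⟨rfl, rfl⟩ := hij
        rw [if_pos ⟨rfl, rfl⟩, if_pos ⟨rfl, rfl⟩, psi1, psi_mul_ebar, add_zero, zero_add]
      · rw [if_neg hij, if_neg]
        · simp
        · rintro ⟨h1, h2⟩
          refine hij ⟨(sw n a h).surjective.injective_comp_right h1, ?_⟩
          rw [← permSetoid_sw_self a h A, h2, permSetoid_sw_self]
    · rw [mul_assoc, mul_assoc, single_mul_single, hx, coPsi_mul_single_of_ebar_mul_eq_zero hx,
        single_mul_single, ebar_mul_psi_mul_eq_zero hx]
      simp
  | yy a b =>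
    simp only [map_mul, π_Yy] at hπ
    simp only [map_mul, coF_Yy, single_mul_single, hπ]
  | pp a b ha hb hab =>
    simp only [map_mul, π_Ps] at hπ
    simp only [map_mul, coF_Ps]
    refine eq_of_mul_single_eq hS (fun j B => ?_) (fun x hx => ?_)
    · simp only [mul_assoc, psi1, psi2, crossDeg_sw]
      rw [sw_of_ne b hb a _ (by omega) (by omega), sw_of_ne b hb (a + 1) _ (by omega) (by omega),
        sw_of_ne a ha b _ (by omega) (by omega), sw_of_ne a ha (b + 1) _ (by omega) (by omega),
        ← mul_assoc (psi _ _ _ _ _), hπ, mul_assoc]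
      congr 1
      ring
    · rw [mul_assoc, mul_assoc, coPsi_mul_single_of_ebar_mul_eq_zero hx,
        coPsi_mul_single_of_ebar_mul_eq_zero hx,
        coPsi_mul_single_of_ebar_mul_eq_zero (ebar_mul_psi_mul_eq_zero hx a ha),
        coPsi_mul_single_of_ebar_mul_eq_zero (ebar_mul_psi_mul_eq_zero hx b hb),
        ← mul_assoc, hπ, mul_assoc]
  | py_eq a h i A hc =>
    simp only [map_mul, map_add, π_Yy, π_Ps, π_Eb, add_mul, one_mul, mul_assoc] at hπ
    simp only [map_mul, map_add, coF_Yy, coF_Ps, coF_Eb, add_mul, one_mul, mul_assoc,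
      single_mul_single, psi1, psiy, hπ, single_add, crossDeg_of_eq hc.1 hc.2]
    norm_num
  | py_ne a h i A hc =>
    simp only [map_mul, π_Yy, π_Ps, π_Eb, mul_assoc] at hπ
    simp only [map_mul, coF_Yy, coF_Ps, coF_Eb, mul_assoc, single_mul_single, psi1, psiy, hπ]
    congr 1
    ring
  | yp_eq a h i A hc =>
    simp only [map_mul, map_add, π_Yy, π_Ps, π_Eb, add_mul, one_mul, mul_assoc] at hπ
    simp only [map_mul, map_add, coF_Yy, coF_Ps, coF_Eb, add_mul, one_mul, mul_assoc,
      single_mul_single, psi1, psiy, hπ, single_add, crossDeg_of_eq hc.1 hc.2]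
    norm_num
  | yp_ne a h i A hc =>
    simp only [map_mul, π_Yy, π_Ps, π_Eb, mul_assoc] at hπ
    simp only [map_mul, coF_Yy, coF_Ps, coF_Eb, mul_assoc, single_mul_single, psi1, psiy, hπ]
    congr 1
    ring
  | sq_eq a h i A hc =>
    simp only [map_mul, map_zero, pow_two, π_Ps, π_Eb, mul_assoc] at hπ
    simp only [map_mul, map_zero, pow_two, coF_Ps, coF_Eb, mul_assoc, psi1, psi2, hπ,
      single_zero]
  | sq_far a h i A hc =>
    simp only [map_mul, pow_two, π_Ps, π_Eb, mul_assoc] at hπ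
    simp only [map_mul, pow_two, coF_Ps, coF_Eb, mul_assoc, psi1, psi2, hπ,
      crossDeg_sw, sw_left, sw_right, crossDeg_comm i A ⟨a + 1, h⟩, crossDeg_of_far hc, add_zero]
  | sq_r a h i A hc =>
    simp only [map_mul, map_sub, pow_two, π_Ps, π_Eb, π_Yy, sub_mul, mul_assoc] at hπ
    simp only [map_mul, map_sub, pow_two, coF_Ps, coF_Eb, coF_Yy, sub_mul, mul_assoc,
      single_mul_single, psi1, psi2, hπ, single_sub, crossDeg_sw, sw_left, sw_right,
      crossDeg_comm i A ⟨a + 1, h⟩, crossDeg_of_adj he (Or.inl hc.1) hc.2]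
    norm_num
  | sq_l a h i A hc =>
    simp only [map_mul, map_sub, pow_two, π_Ps, π_Eb, π_Yy, sub_mul, mul_assoc] at hπ
    simp only [map_mul, map_sub, pow_two, coF_Ps, coF_Eb, coF_Yy, sub_mul, mul_assoc,
      single_mul_single, psi1, psi2, hπ, single_sub, crossDeg_sw, sw_left, sw_right,
      crossDeg_comm i A ⟨a + 1, h⟩, crossDeg_of_adj he (Or.inr hc.1) hc.2]
    norm_num
  | br_r a h i A hc =>
    have s1 := sw_of_ne (n := n) a (by omega) (a + 2) h (by omega) (by omega)
    have s2 := sw_of_ne (n := n) (a + 1) h a (by omega) (by omega) (by omega)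
    have s3 := sw_right (n := n) (a + 1) h h
    have d1 := crossDeg_of_adj he (Or.inl hc.2.1) hc.2.2.1
    have d2 := crossDeg_of_eq hc.1.symm (A.trans hc.2.2.1 hc.2.2.2)
    have d3 := crossDeg_of_adj he (p := ⟨a + 1, by omega⟩) (q := ⟨a + 2, h⟩) (i := i)
      (Or.inr (by rw [hc.1, hc.2.1]; ring)) hc.2.2.2
    simp only [map_mul, map_sub, π_Ps, π_Eb, sub_mul, one_mul, mul_assoc] at hπ
    simp only [map_mul, map_sub, coF_Ps, coF_Eb, sub_mul, one_mul, mul_assoc,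
      psi1, psi2, psi3, hπ, single_sub, crossDeg_sw, sw_left, sw_right, s1, s2, s3, d1, d2, d3,
      add_assoc, Nat.reduceAdd]
    norm_num
  | br_l a h i A hc =>
    have s1 := sw_of_ne (n := n) a (by omega) (a + 2) h (by omega) (by omega)
    have s2 := sw_of_ne (n := n) (a + 1) h a (by omega) (by omega) (by omega)
    have s3 := sw_right (n := n) (a + 1) h h
    have d1 := crossDeg_of_adj he (Or.inr hc.2.1) hc.2.2.1
    have d2 := crossDeg_of_eq hc.1.symm (A.trans hc.2.2.1 hc.2.2.2)
    have d3 := crossDeg_of_adj he (p := ⟨a + 1, by omega⟩) (q := ⟨a + 2, h⟩) (i := i)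
      (Or.inl (by rw [hc.1, hc.2.1]; ring)) hc.2.2.2
    simp only [map_mul, map_add, π_Ps, π_Eb, add_mul, one_mul, mul_assoc] at hπ
    simp only [map_mul, map_add, coF_Ps, coF_Eb, add_mul, one_mul, mul_assoc,
      psi1, psi2, psi3, hπ, single_add, crossDeg_sw, sw_left, sw_right, s1, s2, s3, d1, d2, d3,
      add_assoc, Nat.reduceAdd]
    norm_num
  | br_o a h i A hc =>
    have s1 := sw_of_ne (n := n) a (by omega) (a + 2) h (by omega) (by omega)
    have s2 := sw_of_ne (n := n) (a + 1) h a (by omega) (by omega) (by omega)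
    have s3 := sw_right (n := n) (a + 1) h h
    simp only [map_mul, π_Ps, π_Eb, mul_assoc] at hπ
    simp only [map_mul, coF_Ps, coF_Eb, mul_assoc,
      psi1, psi2, psi3, hπ, crossDeg_sw, sw_left, sw_right, s1, s2, s3,
      add_assoc, Nat.reduceAdd]
    congr 1
    ring

theorem exists_coaction (𝕜 : Type) [Field 𝕜] (e n : ℕ) (he : e = 0 ∨ 3 ≤ e) :
    ∃ δ : E 𝕜 e n →ₐ[𝕜] AddMonoidAlgebra (E 𝕜 e n) ℤ,
      (∀ i A, δ (ebar 𝕜 e n i A) = single 0 (ebar 𝕜 e n i A)) ∧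
      (∀ a, δ (y 𝕜 e n a) = single 2 (y 𝕜 e n a)) ∧
      (∀ a h i A, δ (psi 𝕜 e n a h * ebar 𝕜 e n i A) =
        single (crossDeg i A ⟨a, by omega⟩ ⟨a + 1, h⟩) (psi 𝕜 e n a h * ebar 𝕜 e n i A)) ∧
      (∀ a h (x : E 𝕜 e n), (∀ i A, ebar 𝕜 e n i A * x = 0) → δ x = single 0 x →
        δ (psi 𝕜 e n a h * x) = single 0 (psi 𝕜 e n a h * x)) := by
  obtain ⟨S, hS⟩ := exists_finset_ebar_eq_zero 𝕜 e n
  have key (x) : RingQuot.liftAlgHom 𝕜 ⟨coF S, fun _ _ => coF_eq_of_rel he hS⟩ (π 𝕜 e n x) =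
      coF S x := RingQuot.liftAlgHom_mkAlgHom_apply ..
  refine ⟨RingQuot.liftAlgHom 𝕜 ⟨coF S, fun _ _ => coF_eq_of_rel he hS⟩, fun i A => ?_,
    fun a => ?_, fun a h i A => ?_, fun a h x hx hδ => ?_⟩
  · rw [ebar, key, coF_Eb, ebar]
  · rw [y, key, coF_Yy, y]
  · rw [map_mul, ← π_Eb, ← π_Ps, key, key, coF_Eb, coF_Ps, coPsi_mul_single hS (ebar_mul_self i A),
      add_zero, π_Eb, π_Ps]
  · rw [map_mul, hδ, ← π_Ps, key, coF_Ps, coPsi_mul_single_of_ebar_mul_eq_zero hx, π_Ps]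

end Coaction

/-! ### The grading associated with a coaction -/

open AddMonoidAlgebra in
/-- The elements of weight `m` for a coaction. -/
def weightSpace {R : Type} [Ring R] [Algebra 𝕜 R] (δ : R →ₐ[𝕜] AddMonoidAlgebra R ℤ) (m : ℤ) :
    Submodule 𝕜 R where
  carrier := {x | δ x = single m x}
  add_mem' {x x'} hx hx' := by
    change δ (x + x') = _
    rw [map_add, hx, hx', single_add]
  zero_mem' := by simp
  smul_mem' c x hx := by
    change δ (c • x) = _
    rw [map_smul, hx, smul_single]

section Weight

open AddMonoidAlgebra

variable {R : Type} [Ring R] [Algebra 𝕜 R] {δ : R →ₐ[𝕜] AddMonoidAlgebra R ℤ}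

theorem mem_weightSpace {m : ℤ} {x : R} : x ∈ weightSpace δ m ↔ δ x = single m x := Iff.rfl

theorem mul_mem_weightSpace {m m' : ℤ} {x x' : R} (hx : x ∈ weightSpace δ m)
    (hx' : x' ∈ weightSpace δ m') : x * x' ∈ weightSpace δ (m + m') := by
  rw [mem_weightSpace] at *
  rw [map_mul, hx, hx', single_mul_single]

theorem one_mem_weightSpace : (1 : R) ∈ weightSpace δ 0 := by
  rw [mem_weightSpace, map_one, one_def]

theorem coeff_coaction_coe (v : DirectSum ℤ fun m => weightSpace δ m) (m : ℤ) :
    (δ (DirectSum.coeAddMonoidHom (weightSpace δ) v)).coeff m = v m := by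
  induction v using DirectSum.induction_on with
  | zero => simp
  | of k x =>
    rw [DirectSum.coeAddMonoidHom_of, mem_weightSpace.1 x.2, coeff_single]
    by_cases h : k = m
    · subst h
      simp
    · rw [Finsupp.single_eq_of_ne (Ne.symm h), DirectSum.of_eq_of_ne _ _ _ (Ne.symm h)]
      rfl
  | add u v hu hv => simp [hu, hv]

theorem mul_mem_iSup_weightSpace {x x' : R} (hx : x ∈ iSup (weightSpace δ))
    (hx' : x' ∈ iSup (weightSpace δ)) : x * x' ∈ iSup (weightSpace δ) := by
  induction hx using Submodule.iSup_induction' with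
  | mem m x hm =>
    induction hx' using Submodule.iSup_induction' with
    | mem m' x' hm' => exact Submodule.mem_iSup_of_mem _ (mul_mem_weightSpace hm hm')
    | zero => simp
    | add u v _ _ hu hv => rw [mul_add]; exact add_mem hu hv
  | zero => simp
  | add u v _ _ hu hv => rw [add_mul]; exact add_mem hu hv

theorem isInternal_weightSpace (h : iSup (weightSpace δ) = ⊤) :
    DirectSum.IsInternal (weightSpace δ) := by
  constructor
  · intro u v huv
    ext m
    rw [← coeff_coaction_coe, ← coeff_coaction_coe, huv]
  · intro x
    have hx : x ∈ iSup (weightSpace δ) := h ▸ Submodule.mem_top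
    obtain ⟨v, hv⟩ := (Submodule.mem_iSup_iff_exists_dfinsupp (weightSpace δ) x).1 hx
    exact ⟨v, hv⟩

end Weight

theorem iSup_eq_top_of_generators (P : Submodule 𝕜 (E 𝕜 e n)) (h1 : (1 : E 𝕜 e n) ∈ P)
    (hmul : ∀ x x', x ∈ P → x' ∈ P → x * x' ∈ P) (he : ∀ i A, ebar 𝕜 e n i A ∈ P)
    (hy : ∀ a, y 𝕜 e n a ∈ P) (hpsi : ∀ a h, psi 𝕜 e n a h ∈ P) : P = ⊤ := by
  rw [Submodule.eq_top_iff']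
  intro x
  obtain ⟨f, rfl⟩ := RingQuot.mkAlgHom_surjective 𝕜 (Rel 𝕜 e n) x
  induction f using FreeAlgebra.induction with
  | grade0 r => rw [AlgHom.commutes, Algebra.algebraMap_eq_smul_one]; exact P.smul_mem _ h1
  | grade1 g =>
    cases g with
    | eb i A => exact he i A
    | y a => exact hy a
    | psi a h => exact hpsi a h
  | mul u v hu hv => rw [map_mul]; exact hmul _ _ hu hv
  | add u v hu hv => rw [map_add]; exact P.add_mem hu hv

end EG

open EG in
/-- the algebra `E_n(Γ_e)` is `ℤ`-graded: there is a direct sum decomposition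
into `𝕜`-subspaces `Em` with `Em · Em' ⊆ E(m+m')`, `1 ∈ E 0`, each `ē(i,A)` in degree `0`,
each `y_a` in degree `2`, and `ψ_a ē(i,A)` in degree `0`, `1`, `−2` according to the three
listed cases (0-based indices). -/
theorem statement18 (𝕜 : Type) [Field 𝕜] (e n : ℕ) (he : e = 0 ∨ 3 ≤ e) :
    ∃ Em : ℤ → Submodule 𝕜 (EG.E 𝕜 e n),
      DirectSum.IsInternal Em
      ∧ (∀ (m m' : ℤ) (x y : EG.E 𝕜 e n), x ∈ Em m → y ∈ Em m' → x * y ∈ Em (m + m'))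
      ∧ (1 : EG.E 𝕜 e n) ∈ Em 0
      ∧ (∀ (i : Fin n → ZMod e) (A : Setoid (Fin n)), ebar 𝕜 e n i A ∈ Em 0)
      ∧ (∀ a : Fin n, y 𝕜 e n a ∈ Em 2)
      ∧ (∀ (a : ℕ) (h : a + 1 < n) (i : Fin n → ZMod e) (A : Setoid (Fin n)),
          ((i ⟨a + 1, h⟩ ≠ i ⟨a, by omega⟩ - 1 ∧ i ⟨a + 1, h⟩ ≠ i ⟨a, by omega⟩
              ∧ i ⟨a + 1, h⟩ ≠ i ⟨a, by omega⟩ + 1)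
            ∨ ¬ A.r ⟨a, by omega⟩ ⟨a + 1, h⟩ →
            psi 𝕜 e n a h * ebar 𝕜 e n i A ∈ Em 0)
          ∧ ((i ⟨a + 1, h⟩ = i ⟨a, by omega⟩ + 1 ∨ i ⟨a + 1, h⟩ = i ⟨a, by omega⟩ - 1)
              ∧ A.r ⟨a, by omega⟩ ⟨a + 1, h⟩ →
            psi 𝕜 e n a h * ebar 𝕜 e n i A ∈ Em 1)
          ∧ (i ⟨a + 1, h⟩ = i ⟨a, by omega⟩ ∧ A.r ⟨a, by omega⟩ ⟨a + 1, h⟩ →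
            psi 𝕜 e n a h * ebar 𝕜 e n i A ∈ Em (-2))) := by
  obtain ⟨δ, hδe, hδy, hδp, hδc⟩ := exists_coaction 𝕜 e n he
  obtain ⟨S, hS⟩ := exists_finset_ebar_eq_zero 𝕜 e n
  have hE (i A) : ebar 𝕜 e n i A ∈ weightSpace δ 0 := hδe i A
  have hsum : (1 - ∑ s ∈ S, ebar 𝕜 e n s.1 s.2) ∈ weightSpace δ 0 :=
    sub_mem one_mem_weightSpace (sum_mem fun s _ => hE s.1 s.2)
  refine ⟨weightSpace δ, isInternal_weightSpace ?_, fun m m' x x' => mul_mem_weightSpace,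
    one_mem_weightSpace, hE, hδy, fun a h i A => ⟨fun hc => ?_, fun hc => ?_, fun hc => ?_⟩⟩
  · refine iSup_eq_top_of_generators _ (Submodule.mem_iSup_of_mem 0 one_mem_weightSpace)
      (fun x x' => mul_mem_iSup_weightSpace) (fun i A => Submodule.mem_iSup_of_mem 0 (hE i A))
      (fun a => Submodule.mem_iSup_of_mem 2 (hδy a)) fun a h => ?_
    have hdec : psi 𝕜 e n a h = psi 𝕜 e n a h * (1 - ∑ s ∈ S, ebar 𝕜 e n s.1 s.2) +
        ∑ s ∈ S, psi 𝕜 e n a h * ebar 𝕜 e n s.1 s.2 := by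
      rw [← Finset.mul_sum, ← mul_add, sub_add_cancel, mul_one]
    rw [hdec]
    exact add_mem
      (Submodule.mem_iSup_of_mem 0 (hδc a h _ (ebar_mul_one_sub_sum hS) hsum))
      (sum_mem fun s _ => Submodule.mem_iSup_of_mem _ (hδp a h s.1 s.2))
  · exact crossDeg_of_far hc ▸ hδp a h i A
  · exact crossDeg_of_adj he hc.1 hc.2 ▸ hδp a h i A
  · exact crossDeg_of_eq hc.1.symm hc.2 ▸ hδp a h i A

end
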